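/- Let ρ₀ be an n×n density matrix, let H_A, H_B, G, O be Hermitian n×n complex matrices, and let U_A, U_B be n×n unitary matrices. Set g = |Tr[ρ₀·[G,O]]|, K = max(‖H_B‖, ‖[H_A,O]‖), Q = max(‖[G,O]‖, ‖G‖), and assume g > 0. Suppose ε ≥ 0 and t_A, t_B ≥ 0 satisfy ‖U_A − exp(-i·t_A·H_A)‖ ≤ ε, ‖U_B − exp(-i·t_B·H_B)‖ ≤ ε, and t_A + t_B ≤ g/(4·K·Q). Then |i·Tr[U_B·ρ₀·U_B†·[G, U_A†·O·U_A]]| ≥ g/2 − 8·ε·‖G‖·‖O‖. -/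

import Mathlib

open scoped Matrix.Norms.L2Operator ComplexOrder
open Matrix NormedSpace

section CStarAlgebra

variable {A : Type*} [CStarAlgebra A]

/-- The unitary generated by a self-adjoint element at a real time. -/
lemma exp_neg_I_mul_real_smul_mem_unitary {H : A} (hH : IsSelfAdjoint H) (t : ℝ) :
    exp ((-Complex.I * (t : ℂ)) • H) ∈ unitary A := by
  let +nondep : NormedAlgebra ℚ A := .restrictScalars ℚ ℂ A
  refine exp_mem_unitary_of_mem_skewAdjoint (skewAdjoint.mem_iff.mpr ?_)
  simp [star_smul, hH.star_eq]

lemma norm_commutator_le (a b : A) : ‖a * b - b * a‖ ≤ 2 * ‖a‖ * ‖b‖ := by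
  have h₁ := norm_sub_le (a * b) (b * a)
  have h₂ := norm_mul_le a b
  have h₃ := norm_mul_le b a
  linarith

lemma norm_star_mul_mul_of_mem_unitary {U : A} (hU : U ∈ unitary A) (X : A) :
    ‖star U * X * U‖ = ‖X‖ := by
  rw [CStarRing.norm_mul_mem_unitary _ hU,
    CStarRing.norm_mem_unitary_mul _ (Unitary.star_mem hU)]

/-- Unitary conjugation is Lipschitz in the unitary. -/
lemma norm_unitary_conj_sub_conj_le {U V : A} (hU : U ∈ unitary A) (hV : V ∈ unitary A) (X : A) :
    ‖star U * X * U - star V * X * V‖ ≤ 2 * ‖U - V‖ * ‖X‖ := by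
  have hsplit : star U * X * U - star V * X * V =
      star U * (X * (U - V)) + star (U - V) * X * V := by
    rw [star_sub]; noncomm_ring
  rw [hsplit]
  refine (norm_add_le _ _).trans ?_
  rw [CStarRing.norm_mem_unitary_mul _ (Unitary.star_mem hU), CStarRing.norm_mul_mem_unitary _ hV]
  have h₁ := norm_mul_le X (U - V)
  have h₂ := norm_mul_le (star (U - V)) X
  rw [norm_star] at h₂
  linarith

/-- Heisenberg evolution under `H` for time `t` moves `X` by at most `t * ‖[H, X]‖`. -/
lemma norm_exp_conj_sub_le {H : A} (hH : IsSelfAdjoint H) (X : A) {t : ℝ} (ht : 0 ≤ t) :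
    ‖star (exp ((-Complex.I * (t : ℂ)) • H)) * X * exp ((-Complex.I * (t : ℂ)) • H) - X‖ ≤
      t * ‖H * X - X * H‖ := by
  let V : ℝ → A := fun s => exp ((-Complex.I * (s : ℂ)) • H)
  have hVmem (s : ℝ) : V s ∈ unitary A := exp_neg_I_mul_real_smul_mem_unitary hH s
  have hV (s : ℝ) : HasDerivAt V ((-Complex.I • H) * V s) s := by
    have hsmul (u : ℝ) : (-Complex.I * (u : ℂ)) • H = u • (-Complex.I • H) := by
      rw [mul_comm, mul_smul, Complex.coe_smul]
    simpa only [V, hsmul] using hasDerivAt_exp_smul_const' (𝕂 := ℝ) (-Complex.I • H) s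
  have hstar : star (-Complex.I • H) = Complex.I • H := by
    simp [star_smul, hH.star_eq]
  have hf (s : ℝ) : HasDerivAt (fun u => star (V u) * X * V u)
      (star (V s) * (Complex.I • (H * X - X * H)) * V s) s := by
    have h := ((hV s).star.mul_const X).mul (hV s)
    refine h.congr_deriv ?_
    rw [star_mul, hstar]
    simp only [mul_assoc, neg_mul, mul_neg, smul_mul_assoc, mul_smul_comm, smul_sub, mul_sub,
      sub_mul, neg_smul]
    abel
  have hbound := norm_image_sub_le_of_norm_deriv_le_segment' (a := 0) (b := t)
    (fun s _ => (hf s).hasDerivWithinAt) (C := ‖H * X - X * H‖)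
    (fun s _ => by rw [norm_star_mul_mul_of_mem_unitary (hVmem s), norm_smul]; simp)
    t ⟨ht, le_rfl⟩
  simpa [V, mul_comm t] using hbound

end CStarAlgebra

/-- Duality between the trace norm of a positive matrix and the operator norm. -/
lemma Matrix.PosSemidef.norm_trace_mul_le {m : Type*} [Fintype m] [DecidableEq m]
    {ρ : Matrix m m ℂ} (hρ : ρ.PosSemidef) (X : Matrix m m ℂ) :
    ‖(ρ * X).trace‖ ≤ ‖ρ.trace‖ * ‖X‖ := by
  obtain ⟨k, v, rfl⟩ := Matrix.posSemidef_iff_eq_sum_vecMulVec.mp hρ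
  have htrace : (∑ i, vecMulVec (v i) (star (v i))).trace =
      ((∑ i, ‖WithLp.toLp 2 (v i)‖ ^ 2 : ℝ) : ℂ) := by
    rw [trace_sum]
    push_cast
    refine Finset.sum_congr rfl fun i _ => ?_
    rw [trace_vecMulVec, ← EuclideanSpace.inner_toLp_toLp, inner_self_eq_norm_sq_to_K]
    rfl
  rw [htrace, Complex.norm_real, Real.norm_of_nonneg (by positivity), Finset.sum_mul,
    Finset.sum_mul, trace_sum]
  refine norm_sum_le_of_le _ fun i _ => ?_
  have hinner : (vecMulVec (v i) (star (v i)) * X).trace =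
      inner ℂ (WithLp.toLp 2 (v i)) (WithLp.toLp 2 (X *ᵥ v i)) := by
    rw [trace_mul_comm, mul_vecMulVec, trace_vecMulVec, EuclideanSpace.inner_toLp_toLp]
  rw [hinner]
  refine (norm_inner_le_norm _ _).trans ?_
  have hX : ‖WithLp.toLp 2 (X *ᵥ v i)‖ ≤ ‖X‖ * ‖WithLp.toLp 2 (v i)‖ :=
    Matrix.l2_opNorm_mulVec X (WithLp.toLp 2 (v i))
  calc _ ≤ ‖WithLp.toLp 2 (v i)‖ * (‖X‖ * ‖WithLp.toLp 2 (v i)‖) := by gcongr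
    _ = _ := by ring

/-- For a density matrix `ρ₀`, Hermitian `H_A, H_B, G, O`, and unitaries
`U_A, U_B`, with `g = |Tr[ρ₀ [G,O]]| > 0`, `K = max(‖H_B‖, ‖[H_A,O]‖)`,
`Q = max(‖[G,O]‖, ‖G‖)`, if `ε ≥ 0` and `t_A, t_B ≥ 0` satisfy
`‖U_A − exp(-i t_A H_A)‖ ≤ ε`, `‖U_B − exp(-i t_B H_B)‖ ≤ ε` and `t_A + t_B ≤ g/(4KQ)`,
then `|i·Tr[U_B ρ₀ U_B† [G, U_A† O U_A]]| ≥ g/2 − 8 ε ‖G‖ ‖O‖`. -/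
theorem stmt_7 {n : ℕ} (ρ₀ H_A H_B G O U_A U_B : Matrix (Fin n) (Fin n) ℂ)
    (hρ : ρ₀.PosSemidef) (hρtr : ρ₀.trace = 1)
    (hHA : H_A.IsHermitian) (hHB : H_B.IsHermitian)
    (hG : G.IsHermitian) (hO : O.IsHermitian)
    (hUA : U_A ∈ Matrix.unitaryGroup (Fin n) ℂ) (hUB : U_B ∈ Matrix.unitaryGroup (Fin n) ℂ)
    (g K Q : ℝ)
    (hg : g = ‖(ρ₀ * (G * O - O * G)).trace‖)
    (hK : K = max ‖H_B‖ ‖H_A * O - O * H_A‖)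
    (hQ : Q = max ‖G * O - O * G‖ ‖G‖)
    (hgpos : 0 < g)
    (ε t_A t_B : ℝ) (hε : 0 ≤ ε) (htA : 0 ≤ t_A) (htB : 0 ≤ t_B)
    (hUAc : ‖U_A - exp ((-Complex.I * (t_A : ℂ)) • H_A)‖ ≤ ε)
    (hUBc : ‖U_B - exp ((-Complex.I * (t_B : ℂ)) • H_B)‖ ≤ ε)
    (ht : t_A + t_B ≤ g / (4 * K * Q)) :
    g / 2 - 8 * ε * ‖G‖ * ‖O‖ ≤
      ‖Complex.I * (U_B * ρ₀ * U_Bᴴ * (G * (U_Aᴴ * O * U_A) - (U_Aᴴ * O * U_A) * G)).trace‖ := by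
  set V_A := exp ((-Complex.I * (t_A : ℂ)) • H_A)
  set V_B := exp ((-Complex.I * (t_B : ℂ)) • H_B)
  have hVA : V_A ∈ unitary _ := exp_neg_I_mul_real_smul_mem_unitary hHA t_A
  have hVB : V_B ∈ unitary _ := exp_neg_I_mul_real_smul_mem_unitary hHB t_B
  set W := U_Aᴴ * O * U_A
  set Y := G * W - W * G with hY
  set C := G * O - O * G with hC
  have hWO : ‖W - O‖ ≤ 2 * ε * ‖O‖ + t_A * K := by
    have h₁ : ‖W - star V_A * O * V_A‖ ≤ 2 * ‖U_A - V_A‖ * ‖O‖ :=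
      norm_unitary_conj_sub_conj_le hUA hVA O
    have h₂ : ‖star V_A * O * V_A - O‖ ≤ t_A * ‖H_A * O - O * H_A‖ :=
      norm_exp_conj_sub_le hHA O htA
    have h₃ : ‖H_A * O - O * H_A‖ ≤ K := hK ▸ le_max_right _ _
    calc _ ≤ _ := norm_sub_le_norm_sub_add_norm_sub W (star V_A * O * V_A) O
      _ ≤ 2 * ‖U_A - V_A‖ * ‖O‖ + t_A * ‖H_A * O - O * H_A‖ := add_le_add h₁ h₂
      _ ≤ _ := by gcongr
  have hYnorm : ‖Y‖ ≤ 2 * ‖G‖ * ‖O‖ := by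
    have hWnorm : ‖W‖ = ‖O‖ := norm_star_mul_mul_of_mem_unitary hUA O
    exact hWnorm ▸ norm_commutator_le G W
  have hYC : ‖Y - C‖ ≤ 2 * ‖G‖ * (2 * ε * ‖O‖) + 2 * t_A * (K * Q) := by
    have hcomm : Y - C = G * (W - O) - (W - O) * G := by
      rw [hY, hC]; noncomm_ring
    have hGQ : ‖G‖ ≤ Q := hQ ▸ le_max_right _ _
    have hK0 : 0 ≤ K := hK ▸ le_max_of_le_left (norm_nonneg _)
    calc ‖Y - C‖ ≤ 2 * ‖G‖ * ‖W - O‖ := hcomm ▸ norm_commutator_le G (W - O)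
      _ ≤ 2 * ‖G‖ * (2 * ε * ‖O‖ + t_A * K) := by gcongr
      _ = 2 * ‖G‖ * (2 * ε * ‖O‖) + 2 * t_A * (K * ‖G‖) := by ring
      _ ≤ _ := by gcongr
  have hUY : ‖star U_B * Y * U_B - star V_B * Y * V_B‖ ≤ 2 * ε * (2 * ‖G‖ * ‖O‖) :=
    (norm_unitary_conj_sub_conj_le hUB hVB Y).trans (by gcongr)
  have hVC : ‖star V_B * C * V_B - C‖ ≤ 2 * t_B * (K * Q) := by
    have hHK : ‖H_B‖ ≤ K := hK ▸ le_max_left _ _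
    have hCQ : ‖C‖ ≤ Q := hQ ▸ le_max_left _ _
    calc _ ≤ t_B * ‖H_B * C - C * H_B‖ := norm_exp_conj_sub_le hHB C htB
      _ ≤ t_B * (2 * ‖H_B‖ * ‖C‖) := by gcongr; exact norm_commutator_le H_B C
      _ = 2 * t_B * (‖H_B‖ * ‖C‖) := by ring
      _ ≤ _ := by gcongr; exact (norm_nonneg _).trans hHK
  have hdiff : ‖star U_B * Y * U_B - C‖ ≤
      8 * ε * ‖G‖ * ‖O‖ + 2 * (t_A + t_B) * (K * Q) := by
    have hsplit : star U_B * Y * U_B - C = (star U_B * Y * U_B - star V_B * Y * V_B) +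
        star V_B * (Y - C) * V_B + (star V_B * C * V_B - C) := by noncomm_ring
    have h := norm_add₃_le (a := star U_B * Y * U_B - star V_B * Y * V_B)
      (b := star V_B * (Y - C) * V_B) (c := star V_B * C * V_B - C)
    rw [← hsplit, norm_star_mul_mul_of_mem_unitary hVB] at h
    linarith
  have htime : 2 * (t_A + t_B) * (K * Q) ≤ g / 2 := by
    have hKQ : 0 ≤ K * Q := mul_nonneg (hK ▸ le_max_of_le_left (norm_nonneg _))
      (hQ ▸ le_max_of_le_left (norm_nonneg _))
    rcases hKQ.eq_or_lt with h | h
    · rw [← h]; linarith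
    · rw [mul_assoc, le_div_iff₀ (by positivity)] at ht
      linarith
  have hcycle : (U_B * ρ₀ * U_Bᴴ * Y).trace = (ρ₀ * (star U_B * Y * U_B)).trace := by
    rw [mul_assoc, mul_assoc, trace_mul_comm, star_eq_conjTranspose]
    simp only [mul_assoc]
  have hdual := hρ.norm_trace_mul_le (star U_B * Y * U_B - C)
  rw [hρtr, norm_one, one_mul, mul_sub, trace_sub, norm_sub_rev] at hdual
  have htri := norm_sub_norm_le (ρ₀ * C).trace (ρ₀ * (star U_B * Y * U_B)).trace
  rw [norm_mul, Complex.norm_I, one_mul, hcycle]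
  linarith
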